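/- arXiv:1412.7985 — 2 statements merged into one kernel-verified Lean document; each statement's English description precedes it below -/
import Mathlib

section
/- Let g(x,t) = 1/t + (x/t)·log(1/(1−t)) for x ≥ 1 and t ∈ (0,1), let G(x) = inf_{0<t<1} g(x,t), and define β by β(1) = 1 and β(n+1) = G(β(n)) for n ≥ 1. Then the map n ↦ β(n+1) − β(n) is nondecreasing; that is, for all n ≥ 1 one has β(n+2) − β(n+1) ≥ β(n+1) − β(n). In particular n ↦ β(n) is convex. -/
open Set

/-- `g x t = 1/t + (x/t)·log(1/(1−t))`. -/
noncomputable def g (x t : ℝ) : ℝ := 1 / t + (x / t) * Real.log (1 / (1 - t))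

/-- `G x = inf_{0<t<1} g x t`. -/
noncomputable def G (x : ℝ) : ℝ := sInf ((fun t => g x t) '' Set.Ioo (0 : ℝ) 1)

/-- The sequence `β` with `β 1 = 1` and `β (n+1) = G (β n)` for `n ≥ 1`
(the value at `0` is irrelevant). -/
noncomputable def beta : ℕ → ℝ
  | 0 => 0
  | 1 => 1
  | n + 2 => G (beta (n + 1))

lemma one_le_inv_mul_log {t : ℝ} (ht : t ∈ Ioo (0 : ℝ) 1) :
    1 ≤ 1 / t * Real.log (1 / (1 - t)) := by
  have hlog : t ≤ Real.log (1 / (1 - t)) := by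
    rw [one_div, Real.log_inv]
    linarith [Real.log_le_sub_one_of_pos (sub_pos.2 ht.2)]
  rw [one_div_mul_eq_div]
  exact (one_le_div ht.1).2 hlog

lemma g_add_sub_le {x y t : ℝ} (hxy : x ≤ y) (ht : t ∈ Ioo (0 : ℝ) 1) :
    g x t + (y - x) ≤ g y t := by
  have h : g y t = g x t + (y - x) * (1 / t * Real.log (1 / (1 - t))) := by
    unfold g
    ring
  rw [h]
  gcongr
  exact le_mul_of_one_le_right (sub_nonneg.2 hxy) (one_le_inv_mul_log ht)

lemma le_g {x t : ℝ} (hx : 0 ≤ x) (ht : t ∈ Ioo (0 : ℝ) 1) : x ≤ g x t := by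
  have h := g_add_sub_le hx ht
  have h0 : 0 ≤ g 0 t := by
    simpa [g] using ht.1.le
  linarith

lemma le_G_of_forall {x c : ℝ} (h : ∀ t ∈ Ioo (0 : ℝ) 1, c ≤ g x t) : c ≤ G x :=
  le_csInf ((nonempty_Ioo.2 one_pos).image _) (forall_mem_image.2 h)

lemma G_le_g {x t : ℝ} (hx : 0 ≤ x) (ht : t ∈ Ioo (0 : ℝ) 1) : G x ≤ g x t :=
  csInf_le ⟨x, forall_mem_image.2 fun _ hs => le_g hx hs⟩ (mem_image_of_mem _ ht)

lemma le_G {x : ℝ} (hx : 0 ≤ x) : x ≤ G x :=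
  le_G_of_forall fun _ ht => le_g hx ht

lemma G_add_sub_le {x y : ℝ} (hx : 0 ≤ x) (hxy : x ≤ y) : G x + (y - x) ≤ G y :=
  le_G_of_forall fun _ ht => by linarith [G_le_g hx ht, g_add_sub_le hxy ht]

lemma beta_add_two (n : ℕ) : beta (n + 2) = G (beta (n + 1)) := by
  rw [beta]

lemma beta_succ_nonneg (n : ℕ) : 0 ≤ beta (n + 1) := by
  induction n with
  | zero => simp [beta]
  | succ n ih => exact beta_add_two n ▸ ih.trans (le_G ih)

theorem beta_differences_monotone :
    ∀ n : ℕ, 1 ≤ n → beta (n + 1) - beta n ≤ beta (n + 2) - beta (n + 1) := by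
  intro n hn
  obtain ⟨k, rfl⟩ := Nat.exists_eq_add_of_le' hn
  have hk := beta_succ_nonneg k
  have h := G_add_sub_le hk (le_G hk)
  rw [beta_add_two (k + 1), beta_add_two k]
  linarith
end

section
/- For x ≥ 1 let H(x) ∈ (0,1) denote the unique minimizer over t ∈ (0,1) of g(x,t) = 1/t + (x/t)·log(1/(1−t)). Then there exists a constant C such that |H(x) − √(2/x)| ≤ C/x for all x ≥ 1; in particular H(x) = √(2/x)·(1 + O(x^{−1/2})) as x → ∞. -/
open Set

/-- The first-order condition for an interior minimizer of `g x`. -/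
lemma one_div_eq_of_g_le {x t : ℝ} (hx : 0 < x) (ht : t ∈ Ioo (0 : ℝ) 1)
    (hmin : ∀ s ∈ Ioo (0 : ℝ) 1, g x t ≤ g x s) :
    1 / x = Real.log (1 - t) + t / (1 - t) := by
  have ht0 : t ≠ 0 := ht.1.ne'
  have ht1 : 1 - t ≠ 0 := (sub_pos.2 ht.2).ne'
  have hg : g x = fun s ↦ (1 - x * Real.log (1 - s)) / s := by
    funext s
    rw [g, one_div (1 - s), Real.log_inv]
    ring
  have hlog : HasDerivAt (fun s : ℝ ↦ Real.log (1 - s)) (-1 / (1 - t)) t :=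
    ((hasDerivAt_id t).const_sub 1).log ht1
  have hderiv := ((hlog.const_mul x).const_sub 1).fun_div (hasDerivAt_id t) ht0
  have hloc : IsLocalMin (g x) t :=
    Filter.eventually_of_mem (Ioo_mem_nhds ht.1 ht.2) hmin
  rw [hg] at hloc
  have hzero := hloc.hasDerivAt_eq_zero hderiv
  simp only [id] at hzero
  field_simp at hzero ⊢
  linarith

lemma sq_div_two_le_log_one_sub_add {t : ℝ} (h0 : 0 ≤ t) (h1 : t < 1) :
    t ^ 2 / 2 ≤ Real.log (1 - t) + t / (1 - t) := by
  have hlog := Real.hasSum_pow_div_log_of_abs_lt_one (abs_lt.2 ⟨by linarith, h1⟩)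
  have hgeom := (hasSum_geometric_of_lt_one h0 h1).mul_left t
  have hle := le_hasSum (hgeom.sub hlog) 1 fun n _ ↦ by
    rw [← pow_succ', sub_nonneg]
    exact div_le_self (by positivity) (by linarith [n.cast_nonneg (α := ℝ)])
  norm_num at hle
  rw [div_eq_mul_inv t]
  linarith

lemma log_one_sub_add_le {t : ℝ} (h0 : 0 ≤ t) (h1 : t < 1) :
    Real.log (1 - t) + t / (1 - t) ≤ (t / (1 - t)) ^ 2 / 2 := by
  have h1t : 0 < 1 - t := sub_pos.2 h1
  set u := t / (1 - t) with hu
  have hu0 : 0 ≤ u := div_nonneg h0 h1t.le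
  have hlog : Real.log (1 - t) = -Real.log (1 + u) := by
    rw [← Real.log_inv, hu]
    congr 1
    field_simp
    ring
  have hle := Real.le_log_one_add_of_nonneg hu0
  have hrat : u - u ^ 2 / 2 ≤ 2 * u / (u + 2) := by
    rw [le_div_iff₀ (by linarith)]
    nlinarith [pow_nonneg hu0 3]
  linarith

/-- If `H x` denotes the (unique) minimizer over `t ∈ (0,1)` of `g x t`, then
`|H x − √(2/x)| ≤ C/x` for some constant `C` and all `x ≥ 1`; that is,
`H(x) = √(2/x)·(1 + O(x^{−1/2}))` as `x → ∞`. -/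
theorem H_asymptotics (H : ℝ → ℝ)
    (hH : ∀ x : ℝ, 1 ≤ x →
      H x ∈ Set.Ioo (0 : ℝ) 1 ∧ ∀ t ∈ Set.Ioo (0 : ℝ) 1, g x (H x) ≤ g x t) :
    ∃ C : ℝ, ∀ x : ℝ, 1 ≤ x → |H x - Real.sqrt (2 / x)| ≤ C / x := by
  refine ⟨2, fun x hx ↦ ?_⟩
  obtain ⟨ht, hmin⟩ := hH x hx
  have hx0 : 0 < x := by linarith
  have h1t : 0 < 1 - H x := sub_pos.2 ht.2
  have hcrit := one_div_eq_of_g_le hx0 ht hmin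
  have hlow := sq_div_two_le_log_one_sub_add ht.1.le ht.2
  have hupp := log_one_sub_add_le ht.1.le ht.2
  have htwo : 2 / x = 2 * (1 / x) := by ring
  have hle : H x ≤ √(2 / x) := Real.le_sqrt_of_sq_le (by linarith)
  have hge : √(2 / x) ≤ H x / (1 - H x) :=
    Real.sqrt_le_iff.2 ⟨div_nonneg ht.1.le h1t.le, by linarith⟩
  rw [le_div_iff₀ h1t] at hge
  have hsq : √(2 / x) ^ 2 = 2 / x := Real.sq_sqrt (by positivity)
  rw [abs_sub_comm, abs_of_nonneg (sub_nonneg.2 hle)]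
  nlinarith [mul_le_mul_of_nonneg_left hle (Real.sqrt_nonneg (2 / x))]
end
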